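/- Let G be a prime tournament and H a prime subtournament of G with 3 ≤ |V(H)| ≤ |V(G)| − 2. Then there exist distinct vertices u, v ∈ V(G)∖V(H) such that the subtournament H+{u,v} is prime. -/

import Mathlib

/-- A tournament on a vertex type `V`: for any two distinct vertices exactly one of the
two possible directed edges is present. -/
structure Tournament (V : Type) where
  rel : V → V → Prop
  asymm : ∀ u v, rel u v → ¬ rel v u
  total : ∀ u v, u ≠ v → rel u v ∨ rel v u

namespace Tournament

variable {V : Type}

/-- `X` is a homogeneous set of the subtournament of `T` induced on `S`. -/
def HomogOn (T : Tournament V) (S X : Set V) : Prop :=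
  X ⊆ S ∧ ∀ v ∈ S \ X, (∀ x ∈ X, T.rel v x) ∨ (∀ x ∈ X, T.rel x v)

/-- The subtournament of `T` induced on `S` is prime: it is a (nonempty) tournament all
of whose homogeneous sets are trivial. -/
def PrimeOn (T : Tournament V) (S : Set V) : Prop :=
  S.Nonempty ∧ ∀ X : Set V, T.HomogOn S X → X.ncard ≤ 1 ∨ X = S

/-- The subtournament of `T` induced on `S` is isomorphic to the tournament on `Fin n`
with edge relation `r`. -/
def IsoOnFin (T : Tournament V) (S : Set V) {n : ℕ} (r : Fin n → Fin n → Prop) : Prop :=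
  ∃ f : Fin n → V, Function.Injective f ∧ Set.range f = S ∧
    ∀ i j : Fin n, r i j ↔ T.rel (f i) (f j)

/-- `T` has a subtournament isomorphic to the tournament on `Fin n` with edge relation `r`. -/
def HasSub (T : Tournament V) {n : ℕ} (r : Fin n → Fin n → Prop) : Prop :=
  ∃ f : Fin n → V, Function.Injective f ∧ ∀ i j : Fin n, r i j ↔ T.rel (f i) (f j)

/-- The subtournament of `T` induced on `S` has a subtournament isomorphic to the
tournament on `Fin n` with edge relation `r`. -/
def HasSubIn (T : Tournament V) (S : Set V) {n : ℕ} (r : Fin n → Fin n → Prop) : Prop :=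
  ∃ f : Fin n → V, Function.Injective f ∧ (∀ i, f i ∈ S) ∧
    ∀ i j : Fin n, r i j ↔ T.rel (f i) (f j)

/-- `v ∈ Ext(H)`: `v` is outside `H` and `H + v` is prime. -/
def mem_Ext (T : Tournament V) (H : Set V) (v : V) : Prop :=
  v ∉ H ∧ T.PrimeOn (insert v H)

/-- `v ∈ Z(H)`: `v` is outside `H` and `H` is a homogeneous set of `H + v`. -/
def mem_Z (T : Tournament V) (H : Set V) (v : V) : Prop :=
  v ∉ H ∧ T.HomogOn (insert v H) H

/-- `v ∈ V_x(H)`: `v` is outside `H` and `{v, x}` is a homogeneous set of `H + v`. -/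
def mem_Vx (T : Tournament V) (H : Set V) (x v : V) : Prop :=
  v ∉ H ∧ T.HomogOn (insert v H) {v, x}

/-- `C` is (the vertex set of) a cyclic triangle of `T`. -/
def CycTri (T : Tournament V) (C : Set V) : Prop :=
  ∃ a b c : V, C = {a, b, c} ∧ T.rel a b ∧ T.rel b c ∧ T.rel c a

/-- The cyclic triangles `C` and `C'` are triangle-connected: there is a sequence of
cyclic triangles from `C` to `C'` in which consecutive triangles share exactly two
vertices. -/
def TriConn (T : Tournament V) (C C' : Set V) : Prop :=
  ∃ m : ℕ, ∃ f : Fin (m + 1) → Set V,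
    f 0 = C ∧ f (Fin.last m) = C' ∧ (∀ i, T.CycTri (f i)) ∧
    ∀ i : Fin m, ((f i.castSucc) ∩ (f i.succ)).ncard = 2

/-- `T` is strongly connected. -/
def StronglyConnected (T : Tournament V) : Prop :=
  ∀ u v : V, Relation.ReflTransGen T.rel u v

/-- The subtournament of `T` induced on `S` is a transitive tournament. -/
def TransOn (T : Tournament V) (S : Set V) : Prop :=
  ∃ m : ℕ, ∃ f : Fin m → V, Function.Injective f ∧ Set.range f = S ∧
    ∀ i j : Fin m, i < j → T.rel (f i) (f j)

end Tournament

/-- The tournament `T_n` (`n = 2k+1` odd) on `Fin n`: `i → j` iff `j - i mod n ∈ {1, …, k}`. -/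
def TTrel (n : ℕ) (i j : Fin n) : Prop :=
  1 ≤ (j.val + n - i.val) % n ∧ (j.val + n - i.val) % n ≤ n / 2

/-- The tournament `U_n`: obtained from `T_n` by reversing all edges with both ends among
the first `k` vertices. -/
def UUrel (n : ℕ) (i j : Fin n) : Prop :=
  if i.val < n / 2 ∧ j.val < n / 2 then TTrel n j i else TTrel n i j

/-- The tournament `W_n` on `Fin n` (vertex `n-1` plays the role of `w_n`). -/
def WWrel (n : ℕ) (i j : Fin n) : Prop :=
  (i.val < j.val ∧ j.val < n - 1) ∨ (j.val = n - 1 ∧ i.val < n - 1 ∧ i.val % 2 = 1) ∨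
    (i.val = n - 1 ∧ j.val < n - 1 ∧ j.val % 2 = 0)

/-- The tournament `P_n` on `Fin n`: `i → j` iff `j - i ≥ 2` or `i = j + 1`. -/
def PPrel (n : ℕ) (i j : Fin n) : Prop := i.val + 2 ≤ j.val ∨ i.val = j.val + 1

/-- The tournament `D_4`: vertex `0` beats the cyclic triangle `{1, 2, 3}`. -/
def DDrel (i j : Fin 4) : Prop :=
  (i = 0 ∧ j ≠ 0) ∨ (i = 1 ∧ j = 2) ∨ (i = 2 ∧ j = 3) ∨ (i = 3 ∧ j = 1)

/-- The tournament `J_n` on `Fin n`: the identity ordering has exactly one backedge,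
from the last vertex to the first. -/
def JJrel (n : ℕ) (i j : Fin n) : Prop :=
  (i.val < j.val ∧ ¬(i.val = 0 ∧ j.val = n - 1)) ∨ (i.val = n - 1 ∧ j.val = 0)

/-- The tournament `K_n` on `Fin n`: the identity ordering has exactly one backedge,
from the last vertex to the second. -/
def KKrel (n : ℕ) (i j : Fin n) : Prop :=
  (i.val < j.val ∧ ¬(i.val = 1 ∧ j.val = n - 1)) ∨ (i.val = n - 1 ∧ j.val = 1)

/-- The tournament `K_n^*` on `Fin n`: the identity ordering has exactly one backedge,
from the second-to-last vertex to the first. -/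
def KKsrel (n : ℕ) (i j : Fin n) : Prop :=
  (i.val < j.val ∧ ¬(i.val = 0 ∧ j.val = n - 2)) ∨ (i.val = n - 2 ∧ j.val = 0)

/-- `(j, i)` (0-indexed, `i < j`) is one of the backedges of the defining ordering of `Q_n`. -/
def Qback (n i j : ℕ) : Prop :=
  (j = n - 2 ∧ i = 0) ∨ (j = n - 1 ∧ i = n - 3) ∨ (j = i + 1 ∧ j ≤ n - 3)

/-- The tournament `Q_n` on `Fin n`. -/
def QQrel (n : ℕ) (i j : Fin n) : Prop :=
  (i.val < j.val ∧ ¬ Qback n i.val j.val) ∨ (j.val < i.val ∧ Qback n j.val i.val)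

/-- `e` is a matching ordering of the tournament with edge relation `r` on `V`:
`e` lists all vertices and every vertex is the head or tail of at most one backedge. -/
def MatchingOrd {V : Type} (r : V → V → Prop) {m : ℕ} (e : Fin m → V) : Prop :=
  Function.Bijective e ∧
    ∀ i : Fin m, {j : Fin m | (i < j ∧ r (e j) (e i)) ∨ (j < i ∧ r (e i) (e j))}.Subsingleton

/-- `e` is a matching ordering of the subtournament induced on `S`. -/
def MatchingOrdOn {V : Type} (r : V → V → Prop) (S : Set V) {m : ℕ} (e : Fin m → V) : Prop :=
  Set.BijOn e Set.univ S ∧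
    ∀ i : Fin m, {j : Fin m | (i < j ∧ r (e j) (e i)) ∨ (j < i ∧ r (e i) (e j))}.Subsingleton

/-- The subtournament induced on `S` is a matching tournament. -/
def IsMatchingOn {V : Type} (r : V → V → Prop) (S : Set V) : Prop :=
  ∃ m : ℕ, ∃ e : Fin m → V, MatchingOrdOn r S e

/-- The permutation `σ_X` of the interval of integers `X = {b, …, a}` (identity off `X`):
the cycle `(b b+2 … a-2 a a-1 a-3 … b+1)` when `|X|` is odd and
`(b b+2 … a-1 a a-2 … b+1)` when `|X|` is even. -/
def sigmaX (b a x : ℕ) : ℕ :=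
  if x < b ∨ a < x then x
  else if a = b then x
  else if (x - b) % 2 = 0 then
    (if x + 2 ≤ a then x + 2 else if x + 1 ≤ a then x + 1 else x - 1)
  else (if b + 3 ≤ x then x - 2 else b)

/-- The permutation `τ_X = (b b+2)(b+1 b+3)` of `X = {b, b+1, b+2, b+3}`. -/
def tauX (b x : ℕ) : ℕ :=
  if x = b then b + 2 else if x = b + 2 then b
  else if x = b + 1 then b + 3 else if x = b + 3 then b + 1 else x

/-- The permutation `π_1` of the interval `{b, …, a}`: product of the transpositions
swapping the 1st and 2nd, 3rd and 4th, … elements of the interval. -/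
def pi1N (b a x : ℕ) : ℕ :=
  if x < b ∨ a < x then x
  else if (x - b) % 2 = 0 then (if x + 1 ≤ a then x + 1 else x)
  else x - 1

/-- The permutation `π_2` of the interval `{b, …, a}`: product of the transpositions
swapping the 2nd and 3rd, 4th and 5th, … elements of the interval. -/
def pi2N (b a x : ℕ) : ℕ :=
  if x < b ∨ a < x then x
  else if x = b then x
  else if (x - b) % 2 = 1 then (if x + 1 ≤ a then x + 1 else x)
  else x - 1

/-- The segment of the ordering `e` on positions `b, …, a` induces a transitive tournament,
with ordering given (relative to the standard ordering `f`) by the permutation `p`. -/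
def SegTrans {V : Type} (T : Tournament V) {n : ℕ} (e : Fin n → V) (b a : ℕ) (p : ℕ → ℕ) : Prop :=
  ∃ f : ℕ → V, (∀ x y : ℕ, b ≤ x → x < y → y ≤ a → T.rel (f x) (f y)) ∧
    ∀ i : Fin n, b ≤ i.val → i.val ≤ a → e i = f (p i.val)

/-- The segment of the ordering `e` on positions `b, …, a` induces a tournament isomorphic
to `P_m` (where `m = a - b + 1`), with ordering given (relative to the defining ordering
`f` of `P_m`) by the permutation `p`. -/
def SegP {V : Type} (T : Tournament V) {n : ℕ} (e : Fin n → V) (b a : ℕ) (p : ℕ → ℕ) : Prop :=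
  ∃ f : ℕ → V,
    (∀ x y : ℕ, b ≤ x → x ≤ a → b ≤ y → y ≤ a →
      (T.rel (f x) (f y) ↔ (x + 2 ≤ y ∨ x = y + 1))) ∧
    ∀ i : Fin n, b ≤ i.val → i.val ≤ a → e i = f (p i.val)

namespace Tournament

variable {V : Type}

/-- Reformulation of homogeneity: no outside vertex distinguishes two vertices of `X`. -/
lemma homogOn_iff (T : Tournament V) (S X : Set V) :
    T.HomogOn S X ↔ X ⊆ S ∧ ∀ v ∈ S, v ∉ X → ∀ x ∈ X, ∀ y ∈ X, T.rel v x → T.rel v y := by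
  constructor
  · rintro ⟨h1, h2⟩
    refine ⟨h1, fun v hv hvX x hx y hy hr => ?_⟩
    rcases h2 v ⟨hv, hvX⟩ with h | h
    · exact h y hy
    · exact absurd hr (T.asymm _ _ (h x hx))
  · rintro ⟨h1, h2⟩
    refine ⟨h1, fun v hv => ?_⟩
    by_cases h : ∃ x ∈ X, T.rel v x
    · obtain ⟨x, hx, hr⟩ := h
      exact Or.inl fun y hy => h2 v hv.1 hv.2 x hx y hy hr
    · push Not at h
      refine Or.inr fun x hx => ?_
      have hne : v ≠ x := fun e => hv.2 (e ▸ hx)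
      exact (T.total v x hne).resolve_left (h x hx)

/-- Elementwise form of primality. -/
lemma primeOn_elem [Finite V] (T : Tournament V) {S : Set V} (h : T.PrimeOn S) (X : Set V)
    (hX : X ⊆ S) (hd : ∀ v ∈ S, v ∉ X → ∀ x ∈ X, ∀ y ∈ X, T.rel v x → T.rel v y) :
    (∀ a ∈ X, ∀ b ∈ X, a = b) ∨ ∀ a ∈ S, a ∈ X := by
  rcases h.2 X ((T.homogOn_iff S X).2 ⟨hX, hd⟩) with h | h
  · left
    exact (Set.ncard_le_one (Set.toFinite X)).1 h
  · right
    rw [h]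
    exact fun a ha => ha

/-- `u` does not distinguish the vertices of `H`. -/
def ZZ (T : Tournament V) (H : Set V) (u : V) : Prop :=
  ∀ h ∈ H, ∀ k ∈ H, T.rel u h → T.rel u k

/-- `u` is a twin of `x` over `H`. -/
def Tw (T : Tournament V) (H : Set V) (x u : V) : Prop :=
  ∀ h ∈ H, h ≠ x → (T.rel u h ↔ T.rel x h)

lemma rel_iff (T : Tournament V) {a b : V} (h : a ≠ b) : T.rel a b ↔ ¬ T.rel b a :=
  ⟨fun h => T.asymm _ _ h, fun h' => (T.total a b h).resolve_right h'⟩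

lemma pair_cases [Finite V] (T : Tournament V) {H : Set V} (hH : T.PrimeOn H) {u v : V}
    (hu : u ∉ H) (hv : v ∉ H) (huv : u ≠ v)
    (hn : ¬ T.PrimeOn (insert u (insert v H))) :
    (T.ZZ H u ∧ T.ZZ H v) ∨
    (T.ZZ H u ∧ ∀ h ∈ H, T.rel u h ↔ T.rel u v) ∨
    (T.ZZ H v ∧ ∀ h ∈ H, T.rel v h ↔ T.rel v u) ∨
    (∀ h ∈ H, T.rel u h ↔ T.rel v h) ∨
    (∃ y ∈ H, T.Tw H y u ∧ (T.rel v u ↔ T.rel v y)) ∨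
    (∃ y ∈ H, T.Tw H y v ∧ (T.rel u v ↔ T.rel u y)) ∨
    (∃ y ∈ H, T.Tw H y u ∧ T.Tw H y v) := by
  have hne : (insert u (insert v H)).Nonempty := ⟨u, by simp⟩
  unfold PrimeOn at hn
  push Not at hn
  obtain ⟨X, hX, hc, hXS⟩ := hn hne
  rw [homogOn_iff] at hX
  obtain ⟨hXs, hd⟩ := hX
  have hXsub : ∀ a ∈ X, a = u ∨ a = v ∨ a ∈ H := fun a ha => by simpa using hXs ha
  have hdH : ∀ w ∈ H, w ∉ X → ∀ x ∈ X, ∀ y ∈ X, T.rel w x → T.rel w y :=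
    fun w hw => hd w (by simp [hw])
  have hdu := hd u (by simp)
  have hdv := hd v (by simp)
  obtain ⟨a, ha, b, hb, hab⟩ := (Set.one_lt_ncard (Set.toFinite X)).1 hc
  have hnot : ¬ (u ∈ X ∧ v ∈ X ∧ ∀ h ∈ H, h ∈ X) := by
    rintro ⟨h1, h2, h3⟩
    refine hXS (Set.Subset.antisymm hXs fun z hz => ?_)
    rcases hz with rfl | rfl | hz
    · exact h1
    · exact h2
    · exact h3 z hz
  have tw : ∀ p ∈ X, ∀ q ∈ X, ∀ h ∈ H, h ∉ X → (T.rel p h ↔ T.rel q h) := by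
    intro p hp q hq h hh hhX
    have h1 : p ≠ h := fun e => hhX (e ▸ hp)
    have h2 : q ≠ h := fun e => hhX (e ▸ hq)
    rw [T.rel_iff h1, T.rel_iff h2]
    exact not_congr ⟨hdH h hh hhX p hp q hq, hdH h hh hhX q hq p hp⟩
  rcases T.primeOn_elem hH (X ∩ H) Set.inter_subset_right
    (fun w hw hwX x hx y hy => hdH w hw (fun h => hwX ⟨h, hw⟩) x hx.1 y hy.1) with hs | hs
  · by_cases hy : ∃ y ∈ H, y ∈ X
    · obtain ⟨y, hyH, hyX⟩ := hy
      have huniq : ∀ h ∈ H, h ≠ y → h ∉ X := fun h hh hhy hhX =>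
        hhy (hs h ⟨hhX, hh⟩ y ⟨hyX, hyH⟩)
      have twu : u ∈ X → T.Tw H y u := fun hx h hh hhy => tw u hx y hyX h hh (huniq h hh hhy)
      have twv : v ∈ X → T.Tw H y v := fun hx h hh hhy => tw v hx y hyX h hh (huniq h hh hhy)
      by_cases h1 : u ∈ X <;> by_cases h2 : v ∈ X
      · exact Or.inr <| Or.inr <| Or.inr <| Or.inr <| Or.inr <| Or.inr ⟨y, hyH, twu h1, twv h2⟩
      · exact Or.inr <| Or.inr <| Or.inr <| Or.inr <| Or.inl
          ⟨y, hyH, twu h1, hdv h2 u h1 y hyX, hdv h2 y hyX u h1⟩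
      · exact Or.inr <| Or.inr <| Or.inr <| Or.inr <| Or.inr <| Or.inl
          ⟨y, hyH, twv h2, hdu h1 v h2 y hyX, hdu h1 y hyX v h2⟩
      · exfalso
        have e : ∀ z ∈ X, z = y := by
          intro z hz
          by_contra hzy
          rcases hXsub z hz with rfl | rfl | hzH
          · exact h1 hz
          · exact h2 hz
          · exact huniq z hzH hzy hz
        exact hab ((e a ha).trans (e b hb).symm)
    · push Not at hy
      have e : u ∈ X ∧ v ∈ X := by
        have ea := hXsub a ha
        have eb := hXsub b hb
        have := hy a
        have := hy b
        grind
      exact Or.inr <| Or.inr <| Or.inr <| Or.inl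
        fun h hh => tw u e.1 v e.2 h hh (hy h hh)
  · have hHX : ∀ h ∈ H, h ∈ X := fun h hh => (hs h hh).1
    by_cases h1 : u ∈ X <;> by_cases h2 : v ∈ X
    · exact absurd ⟨h1, h2, hHX⟩ hnot
    · refine Or.inr <| Or.inr <| Or.inl ⟨fun h hh k hk => hdv h2 h (hHX h hh) k (hHX k hk), ?_⟩
      exact fun h hh => ⟨hdv h2 h (hHX h hh) u h1, hdv h2 u h1 h (hHX h hh)⟩
    · refine Or.inr <| Or.inl ⟨fun h hh k hk => hdu h1 h (hHX h hh) k (hHX k hk), ?_⟩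
      exact fun h hh => ⟨hdu h1 h (hHX h hh) v h2, hdu h1 v h2 h (hHX h hh)⟩
    · exact Or.inl ⟨fun h hh k hk => hdu h1 h (hHX h hh) k (hHX k hk),
        fun h hh k hk => hdv h2 h (hHX h hh) k (hHX k hk)⟩

lemma not_ZZ_Tw [Finite V] (T : Tournament V) {H : Set V} (hH : T.PrimeOn H)
    (h3 : 3 ≤ H.ncard) {u x : V} (hx : x ∈ H) (hz : T.ZZ H u)
    (ht : T.Tw H x u) : False := by
  obtain ⟨a, b, c, ha, hb, hc, hab, hac, hbc⟩ := (Set.two_lt_ncard_iff (Set.toFinite H)).1 h3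
  rcases T.primeOn_elem hH (H \ {x}) Set.sdiff_subset (by
    intro v hv hvX p hp q hq hr
    have hvx : v = x := by
      by_contra h
      exact hvX ⟨hv, h⟩
    subst hvx
    rw [← ht p hp.1 hp.2] at hr
    rw [← ht q hq.1 hq.2]
    exact hz p hp.1 q hq.1 hr) with h | h
  · have key : ∀ p ∈ H, p ≠ x → ∀ q ∈ H, q ≠ x → p = q :=
      fun p hp hpx q hq hqx => h p ⟨hp, hpx⟩ q ⟨hq, hqx⟩
    by_cases e1 : a = x <;> by_cases e2 : b = x <;> grind
  · exact (h x hx).2 rfl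

lemma Tw_unique [Finite V] (T : Tournament V) {H : Set V} (hH : T.PrimeOn H)
    (h3 : 3 ≤ H.ncard) {u x y : V} (hx : x ∈ H) (hy : y ∈ H)
    (hxu : T.Tw H x u) (hyu : T.Tw H y u) : x = y := by
  obtain ⟨a, b, c, ha, hb, hc, hab, hac, hbc⟩ := (Set.two_lt_ncard_iff (Set.toFinite H)).1 h3
  rcases T.primeOn_elem hH {x, y} (by rintro z (rfl | rfl) <;> assumption) (by
    intro v hv hvX
    have hvx : v ≠ x := fun e => hvX (by simp [e])
    have hvy : v ≠ y := fun e => hvX (by simp [e])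
    have h1 := hxu v hv hvx
    have h2 := hyu v hv hvy
    have h3 := T.rel_iff hvx
    have h4 := T.rel_iff hvy
    rintro p (rfl | rfl) q (rfl | rfl) <;> tauto) with h | h
  · exact h x (by simp) y (by simp)
  · have := h a ha
    have := h b hb
    have := h c hc
    simp only [Set.mem_insert_iff, Set.mem_singleton_iff] at *
    grind

lemma pair_Tw [Finite V] (T : Tournament V) {H : Set V} (hH : T.PrimeOn H)
    (h3 : 3 ≤ H.ncard) {u v x : V} (hu : u ∉ H) (hv : v ∉ H) (hx : x ∈ H)
    (hxu : T.Tw H x u) (hxv : ¬ T.Tw H x v)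
    (hn : ¬ T.PrimeOn (insert u (insert v H))) : T.rel v u ↔ T.rel v x := by
  have huv : u ≠ v := fun e => hxv (e ▸ hxu)
  rcases T.pair_cases hH hu hv huv hn with h | h | h | h | ⟨y, hy, h⟩ | ⟨y, hy, h⟩ | ⟨y, hy, h⟩
  · exact (T.not_ZZ_Tw hH h3 hx h.1 hxu).elim
  · exact (T.not_ZZ_Tw hH h3 hx h.1 hxu).elim
  · exact (h.2 x hx).symm
  · exact absurd (fun k hk hkx => (h k hk).symm.trans (hxu k hk hkx)) hxv
  · obtain rfl := T.Tw_unique hH h3 hx hy hxu h.1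
    exact h.2
  · have hxy : x ≠ y := by
      rintro rfl
      exact hxv h.1
    have h1 := h.1 x hx hxy
    have h2 := hxu y hy hxy.symm
    have h4 := T.rel_iff huv.symm
    have h5 := T.rel_iff hxy
    tauto
  · obtain rfl := T.Tw_unique hH h3 hx hy hxu h.1
    exact absurd h.2 hxv

lemma pair_ZZ [Finite V] (T : Tournament V) {H : Set V} (hH : T.PrimeOn H)
    (h3 : 3 ≤ H.ncard) {u v : V} (hu : u ∉ H) (hv : v ∉ H)
    (hzu : T.ZZ H u) (hzv : ¬ T.ZZ H v)
    (hn : ¬ T.PrimeOn (insert u (insert v H))) : ∀ h ∈ H, T.rel u h ↔ T.rel u v := by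
  have huv : u ≠ v := fun e => hzv (e ▸ hzu)
  rcases T.pair_cases hH hu hv huv hn with h | h | h | h | ⟨y, hy, h⟩ | ⟨y, hy, h⟩ | ⟨y, hy, h⟩
  · exact absurd h.2 hzv
  · exact h.2
  · exact absurd h.1 hzv
  · exact absurd (fun p hp q hq hr => (h q hq).1 (hzu p hp q hq ((h p hp).2 hr))) hzv
  · exact (T.not_ZZ_Tw hH h3 hy hzu h.1).elim
  · exact fun k hk => ⟨fun hr => h.2.2 (hzu k hk y hy hr), fun hr => hzu y hy k hk (h.2.1 hr)⟩
  · exact (T.not_ZZ_Tw hH h3 hy hzu h.1).elim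

end Tournament

/-- Ehrenfeucht–Rozenberg: a prime subtournament `H` of a prime tournament `G` with
`3 ≤ |V(H)| ≤ |V(G)| - 2` can be extended by two vertices to a prime subtournament. -/
theorem stmt1 {V : Type} [Fintype V] (T : Tournament V)
    (hG : T.PrimeOn Set.univ) (H : Set V) (hH : T.PrimeOn H)
    (h3 : 3 ≤ H.ncard) (h2 : H.ncard ≤ Nat.card V - 2) :
    ∃ u v : V, u ∉ H ∧ v ∉ H ∧ u ≠ v ∧ T.PrimeOn (insert u (insert v H)) := by
  by_contra hcon
  push Not at hcon
  obtain ⟨a, b, c, ha, hb, hc, hab, hac, hbc⟩ := (Set.two_lt_ncard_iff (Set.toFinite H)).1 h3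
  -- no vertex outside `H` is a twin of a vertex of `H`
  have noTw : ∀ x ∈ H, ∀ u, u ∉ H → ¬ T.Tw H x u := by
    intro x hx u hu hxu
    have key : ∀ v, ¬ (v = x ∨ (v ∉ H ∧ T.Tw H x v)) → ∀ w, w ∉ H → T.Tw H x w →
        (T.rel v w ↔ T.rel v x) := by
      intro v hv w hw hxw
      push Not at hv
      by_cases hvH : v ∈ H
      · have h1 := hxw v hvH hv.1
        have h2 := T.rel_iff hv.1
        have h3 := T.rel_iff (fun e => hw (e ▸ hvH) : v ≠ w)
        tauto
      · refine T.pair_Tw hH h3 hw hvH hx hxw (hv.2 hvH) (hcon w v hw hvH ?_)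
        rintro rfl
        exact hv.2 hvH hxw
    rcases T.primeOn_elem hG {w | w = x ∨ (w ∉ H ∧ T.Tw H x w)} (Set.subset_univ _) (by
      intro v _ hv p hp q hq hr
      have hk := key v hv
      rcases hp with rfl | hp <;> rcases hq with rfl | hq
      · exact hr
      · exact (hk q hq.1 hq.2).2 hr
      · exact (hk p hp.1 hp.2).1 hr
      · exact (hk q hq.1 hq.2).2 ((hk p hp.1 hp.2).1 hr)) with h | h
    · exact hu (h x (Or.inl rfl) u (Or.inr ⟨hu, hxu⟩) ▸ hx)
    · have e : ∀ p ∈ H, p = x := fun p hp => (h p trivial).resolve_right fun hw => hw.1 hp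
      exact hab ((e a ha).trans (e b hb).symm)
  -- no vertex outside `H` is homogeneous to `H`
  have noZZ : ∀ u, u ∉ H → ¬ T.ZZ H u := by
    intro u hu hzu
    have key : ∀ v, ¬ (v ∈ H ∨ ¬ T.ZZ H v) → ∀ w, (w ∈ H ∨ ¬ T.ZZ H w) →
        (T.rel v a ↔ T.rel v w) := by
      intro v hv w hw
      push Not at hv
      by_cases hwH : w ∈ H
      · exact ⟨hv.2 a ha w hwH, hv.2 w hwH a ha⟩
      · have hzw := hw.resolve_left hwH
        refine T.pair_ZZ hH h3 hv.1 hwH hv.2 hzw (hcon v w hv.1 hwH ?_) a ha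
        rintro rfl
        exact hzw hv.2
    rcases T.primeOn_elem hG {w | w ∈ H ∨ ¬ T.ZZ H w} (Set.subset_univ _) (by
      intro v _ hv p hp q hq hr
      exact (key v hv q hq).1 ((key v hv p hp).2 hr)) with h | h
    · exact hab (h a (Or.inl ha) b (Or.inl hb))
    · exact (h u trivial).elim hu (fun hw => hw hzu)
  -- hence the complement of `H` is homogeneous
  rcases T.primeOn_elem hG Hᶜ (Set.subset_univ _) (by
    intro w _ hw p hp q hq hr
    have hwH : w ∈ H := by simpa using hw
    by_cases hpq : p = q
    · exact hpq ▸ hr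
    rcases T.pair_cases hH hp hq hpq (hcon p q hp hq hpq) with
      h | h | h | h | ⟨y, hy, h⟩ | ⟨y, hy, h⟩ | ⟨y, hy, h⟩
    · exact (noZZ p hp h.1).elim
    · exact (noZZ p hp h.1).elim
    · exact (noZZ q hq h.1).elim
    · have h1 := h w hwH
      have h2 := T.rel_iff (fun e => hp (e ▸ hwH) : w ≠ p)
      have h3 := T.rel_iff (fun e => hq (e ▸ hwH) : w ≠ q)
      tauto
    · exact (noTw y hy p hp h.1).elim
    · exact (noTw y hy q hq h.1).elim
    · exact (noTw y hy p hp h.1).elim) with h | h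
  · have h4 : Hᶜ.ncard ≤ 1 := (Set.ncard_le_one (Set.toFinite _)).2 h
    have h5 := Set.ncard_add_ncard_compl H
    omega
  · exact h a trivial ha
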